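/- arXiv:1604.05004 — 2 statements merged into one kernel-verified Lean document; each statement's English description precedes it below -/
import Mathlib

section
/- Let the group G = S₄ × ℤ/2ℤ act transitively on a set X with exactly 12 elements, let H be a subgroup of G, and let E ⊆ X be a subset with exactly 7 elements that is invariant under H (i.e., h moves E into E for every h ∈ H). Then every element h ∈ H fixes at least one element of E. -/
open MulAction

/-- An element of `p`-power order acting on a finite invariant set of cardinality prime to `p`
has a fixed point in this set. -/
theorem exists_smul_eq_of_pow_prime_pow_eq_one {G X : Type*} [Group G] [MulAction G X]
    {p n : ℕ} [Fact p.Prime] {g : G} (hg : g ^ p ^ n = 1) {E : Set X}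
    (hE : ¬ p ∣ E.ncard) (hinv : ∀ x, g • x ∈ E ↔ x ∈ E) :
    ∃ e ∈ E, g • e = e := by
  have hfin : E.Finite := Set.finite_of_ncard_ne_zero fun h => hE (h ▸ dvd_zero p)
  have := hfin.fintype
  rw [← Nat.card_coe_set_eq, Nat.card_eq_fintype_card] at hE
  have hinv' : ∀ x, toPermHom G X g x ∈ E ↔ x ∈ E := hinv
  have hσ : ((toPermHom G X g).subtypePerm hinv' : Equiv.Perm E) ^ p ^ n = 1 := by
    refine (Equiv.Perm.subtypePerm_pow _ _ hinv').trans ?_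
    ext x
    change (toPermHom G X g ^ p ^ n) (x : X) = x
    rw [← map_pow, hg, map_one, Equiv.Perm.one_apply]
  obtain ⟨e, he⟩ := Equiv.Perm.exists_fixed_point_of_prime hE hσ
  exact ⟨e, e.2, congrArg Subtype.val he⟩

set_option maxRecDepth 10000 in
theorem pow_four_eq_one_or_pow_six_eq_one
    (g : Equiv.Perm (Fin 4) × Multiplicative (ZMod 2)) : g ^ 4 = 1 ∨ g ^ 6 = 1 := by
  obtain ⟨a, b⟩ := g
  have ha : ∀ a : Equiv.Perm (Fin 4), a ^ 4 = 1 ∨ a ^ 6 = 1 := by decide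
  have hb : ∀ b : Multiplicative (ZMod 2), b ^ 4 = 1 ∧ b ^ 6 = 1 := by decide
  simpa [Prod.ext_iff, hb b] using ha a

theorem card_stabilizer_eq_four {X : Type*}
    [MulAction (Equiv.Perm (Fin 4) × Multiplicative (ZMod 2)) X]
    [IsPretransitive (Equiv.Perm (Fin 4) × Multiplicative (ZMod 2)) X]
    (hcard : Nat.card X = 12) (x : X) :
    Nat.card (stabilizer (Equiv.Perm (Fin 4) × Multiplicative (ZMod 2)) x) = 4 := by
  have h := (stabilizer (Equiv.Perm (Fin 4) × Multiplicative (ZMod 2)) x).card_mul_index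
  have hG : Nat.card (Equiv.Perm (Fin 4) × Multiplicative (ZMod 2)) = 48 := by
    rw [Nat.card_prod, Nat.card_perm, Nat.card_fin, Nat.card_congr Multiplicative.toAdd,
      Nat.card_zmod]
    rfl
  rw [index_stabilizer_of_transitive, hcard, hG] at h
  omega

/-- If `G = S₄ × ℤ/2ℤ` acts transitively on a set `X` of size 12, `H ≤ G` is a
subgroup, and `E ⊆ X` is an `H`-invariant subset of size 7, then every element
of `H` fixes at least one element of `E`. -/
theorem exists_fixed_point_of_invariant_seven_subset
    {X : Type*} [MulAction (Equiv.Perm (Fin 4) × Multiplicative (ZMod 2)) X]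
    (htrans : ∀ x y : X,
      ∃ g : Equiv.Perm (Fin 4) × Multiplicative (ZMod 2), g • x = y)
    (hcard : Nat.card X = 12)
    (H : Subgroup (Equiv.Perm (Fin 4) × Multiplicative (ZMod 2)))
    (E : Set X) (hE : E.ncard = 7)
    (hinv : ∀ h ∈ H, ∀ e ∈ E, h • e ∈ E) :
    ∀ h ∈ H, ∃ e ∈ E, h • e = e := by
  intro h hh
  have := IsPretransitive.mk htrans
  have hmem : ∀ k ∈ H, ∀ x, k • x ∈ E ↔ x ∈ E := fun k hk x =>
    ⟨fun hx => by simpa using hinv k⁻¹ (H.inv_mem hk) _ hx, hinv k hk x⟩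
  have h4 : h ^ 4 = 1 := by
    rcases pow_four_eq_one_or_pow_six_eq_one h with h4 | h6
    · exact h4
    have hcube : (h ^ 2) ^ 3 = 1 := by rw [← pow_mul, h6]
    obtain ⟨e, -, he⟩ := exists_smul_eq_of_pow_prime_pow_eq_one (p := 3) (n := 1)
      (by simpa using hcube) (by rw [hE]; norm_num) (hmem (h ^ 2) (H.pow_mem hh 2))
    have hfour : (h ^ 2) ^ 4 = 1 :=
      orderOf_dvd_iff_pow_eq_one.mp <|
        (Subgroup.orderOf_dvd_natCard _ (mem_stabilizer_iff.mpr he)).trans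
          (card_stabilizer_eq_four hcard e).dvd
    have hsq : h ^ 2 = 1 := by rwa [pow_succ, hcube, one_mul] at hfour
    rw [pow_mul h 2 2, hsq, one_pow]
  exact exists_smul_eq_of_pow_prime_pow_eq_one (p := 2) (n := 2)
    (by simpa using h4) (by rw [hE]; norm_num) (hmem h hh)
end

section
/- An automorphism of a tree can reverse at most one edge: if T is a finite tree (a connected acyclic simple graph), g is a graph automorphism of T, and g reverses the edges {A, A'} and {B, B'} of T — that is, g(A) = A', g(A') = A, g(B) = B', and g(B') = B — then {A, A'} = {B, B'} as unordered pairs. -/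
/-- In a connected graph, deleting an edge leaves every vertex connected to one of its ends. -/
theorem SimpleGraph.Preconnected.reachable_deleteEdges_or {V : Type*} {G : SimpleGraph V}
    (hG : G.Preconnected) (a b v : V) :
    (G.deleteEdges {s(a, b)}).Reachable v a ∨ (G.deleteEdges {s(a, b)}).Reachable v b := by
  obtain ⟨p⟩ := hG v a
  induction p with
  | nil => exact Or.inl (.refl _)
  | @cons v w a h p ih =>
    by_cases he : s(v, w) = s(a, b)
    · rcases Sym2.eq_iff.1 he with ⟨rfl, -⟩ | ⟨rfl, -⟩
      · exact Or.inl (.refl _)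
      · exact Or.inr (.refl _)
    · have hvw : (G.deleteEdges {s(a, b)}).Adj v w := by
        simpa only [SimpleGraph.deleteEdges_adj, Set.mem_singleton_iff] using And.intro h he
      exact ih.imp hvw.reachable.trans hvw.reachable.trans

/-- An automorphism reversing an edge induces a homomorphism of the graph without that edge. -/
def SimpleGraph.Iso.deleteReversedEdge {V : Type*} {G : SimpleGraph V} (g : G ≃g G) {a b : V}
    (hab : g a = b) (hba : g b = a) :
    G.deleteEdges {s(a, b)} →g G.deleteEdges {s(a, b)} where
  toFun := g
  map_rel' {v w} h := by
    rw [SimpleGraph.deleteEdges_adj, Set.mem_singleton_iff] at h ⊢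
    refine ⟨g.map_adj_iff.2 h.1, fun he ↦ h.2 (Sym2.map.injective g.injective ?_)⟩
    rw [Sym2.map_mk, Sym2.map_mk, hab, hba, he, Sym2.eq_swap]

/-- An automorphism of a finite tree can reverse at most one edge: if `g`
reverses the edges `{A, A'}` and `{B, B'}`, then these edges coincide. -/
theorem tree_automorphism_reverses_at_most_one_edge
    {V : Type*} [Fintype V] {T : SimpleGraph V} (hT : T.IsTree)
    (g : T ≃g T) {A A' B B' : V}
    (hAadj : T.Adj A A') (hBadj : T.Adj B B')
    (hgA : g A = A') (hgA' : g A' = A) (hgB : g B = B') (hgB' : g B' = B) :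
    s(A, A') = s(B, B') := by
  by_contra hne
  have hbridge : ¬ (T.deleteEdges {s(A, A')}).Reachable A A' :=
    SimpleGraph.isBridge_iff.1
      (SimpleGraph.isAcyclic_iff_forall_adj_isBridge.1 hT.isAcyclic hAadj)
  have hBB' : (T.deleteEdges {s(A, A')}).Reachable B B' := by
    refine SimpleGraph.Adj.reachable ?_
    rw [SimpleGraph.deleteEdges_adj, Set.mem_singleton_iff]
    exact ⟨hBadj, Ne.symm hne⟩
  rcases hT.connected.preconnected.reachable_deleteEdges_or A A' B with h | h
  · have hmap : (T.deleteEdges {s(A, A')}).Reachable (g B) (g A) :=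
      h.map (g.deleteReversedEdge hgA hgA')
    rw [hgA, hgB] at hmap
    exact hbridge (h.symm.trans (hBB'.trans hmap))
  · have hmap : (T.deleteEdges {s(A, A')}).Reachable (g B) (g A') :=
      h.map (g.deleteReversedEdge hgA hgA')
    rw [hgA', hgB] at hmap
    exact hbridge (hmap.symm.trans (hBB'.symm.trans h))
end
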